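/- Let f ∈ 𝓡(m), let φ : Fin m → Fin n be a map, and suppose g := φ_*f ∈ 𝓡(n). Then the map sending a monomial I in the support of f to the monomial φ_*(∏_{i∈I} a_i) is a bijection from the support of f onto the support of g; moreover, for each monomial I of f, the restriction of φ to the variable-set Γ_I of I is injective, and its image is exactly the variable-set of the corresponding monomial of g. -/

import Mathlib

open MvPolynomial

/-- `f ∈ 𝓡(n)`: `f` is a sum of distinct monic squarefree monomials of positive
degree: all coefficients of monomials in the support are `1`, all exponents are
`≤ 1`, and the constant coefficient vanishes. -/
def IsRPoly {n : ℕ} (f : MvPolynomial (Fin n) ℤ) : Prop :=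
  (∀ d ∈ f.support, f.coeff d = 1) ∧
  (∀ d ∈ f.support, ∀ i, d i ≤ 1) ∧
  f.coeff 0 = 0

theorem MvPolynomial.coeff_rename_eq_sum {σ τ R : Type*} [CommSemiring R] [DecidableEq τ]
    (φ : σ → τ) (p : MvPolynomial σ R) (d : τ →₀ ℕ) :
    (rename φ p).coeff d = ∑ e ∈ p.support with e.mapDomain φ = d, p.coeff e := by
  conv_lhs => rw [p.as_sum]
  simp only [map_sum, rename_monomial, coeff_sum, coeff_monomial, Finset.sum_filter]

theorem Finsupp.injOn_support_of_mapDomain_le_one {α β : Type*} (φ : α → β) (d : α →₀ ℕ)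
    (h : ∀ b, d.mapDomain φ b ≤ 1) : Set.InjOn φ d.support := by
  classical
  intro i hi j hj hij
  by_contra hne
  have hsub : ({i, j} : Finset α) ⊆ {k ∈ d.support | φ k = φ i} := by
    intro k hk
    simp only [Finset.mem_insert, Finset.mem_singleton] at hk
    rcases hk with rfl | rfl
    · exact Finset.mem_filter.2 ⟨hi, rfl⟩
    · exact Finset.mem_filter.2 ⟨hj, hij.symm⟩
  have hsum := Finset.sum_le_sum_of_subset (f := d) hsub
  rw [← Finsupp.mapDomain_apply_eq_sum φ d, Finset.sum_pair hne] at hsum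
  have hle := h (φ i)
  have hi' : d i ≠ 0 := Finsupp.mem_support_iff.1 hi
  have hj' : d j ≠ 0 := Finsupp.mem_support_iff.1 hj
  omega

theorem IsRPoly.coeff_rename_eq_card {m n : ℕ} {f : MvPolynomial (Fin m) ℤ} (hf : IsRPoly f)
    (φ : Fin m → Fin n) (d : Fin n →₀ ℕ) :
    (rename φ f).coeff d = (Finset.card {e ∈ f.support | e.mapDomain φ = d} : ℤ) := by
  rw [coeff_rename_eq_sum,
    Finset.sum_congr rfl fun e he => hf.1 e (Finset.mem_filter.1 he).1]
  simp

/-- Let `f ∈ 𝓡(m)`, `φ : Fin m → Fin n`, and suppose `g := φ_* f ∈ 𝓡(n)`.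
Then `I ↦ φ_* I` (on exponent vectors, `Finsupp.mapDomain φ`) is a bijection
from the support of `f` onto the support of `g`; moreover for each monomial `I`
of `f`, `φ` is injective on the variable-set of `I`, and its image is exactly
the variable-set of the corresponding monomial of `g`. -/
theorem rename_support_bijOn (m n : ℕ) (φ : Fin m → Fin n)
    (f : MvPolynomial (Fin m) ℤ) (hf : IsRPoly f)
    (hg : IsRPoly (MvPolynomial.rename φ f)) :
    Set.BijOn (Finsupp.mapDomain φ : (Fin m →₀ ℕ) → (Fin n →₀ ℕ)) (↑f.support)
      (↑(MvPolynomial.rename φ f).support) ∧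
    ∀ I ∈ f.support,
      Set.InjOn φ (↑I.support) ∧
      I.support.image φ = (Finsupp.mapDomain φ I).support := by
  have mapsTo : ∀ e ∈ f.support, e.mapDomain φ ∈ (rename φ f).support := by
    intro e he
    rw [mem_support_iff, hf.coeff_rename_eq_card, Nat.cast_ne_zero, Finset.card_ne_zero]
    exact ⟨e, Finset.mem_filter.2 ⟨he, rfl⟩⟩
  refine ⟨⟨mapsTo, ?_, ?_⟩, fun I hI => ?_⟩
  · intro d hd e he hde
    have hcard := hg.1 _ (mapsTo d hd)
    rw [hf.coeff_rename_eq_card, Nat.cast_eq_one] at hcard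
    exact Finset.card_le_one.1 hcard.le d (Finset.mem_filter.2 ⟨hd, rfl⟩)
      e (Finset.mem_filter.2 ⟨he, hde.symm⟩)
  · intro d hd
    obtain ⟨e, he, hne⟩ := coeff_rename_ne_zero φ f d (mem_support_iff.1 hd)
    exact ⟨e, mem_support_iff.2 hne, he⟩
  · have hinj := Finsupp.injOn_support_of_mapDomain_le_one φ I (hg.2.1 _ (mapsTo I hI))
    exact ⟨hinj, (Finsupp.mapDomain_support_of_injOn I hinj).symm⟩
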